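/- Let (G,S,T) be an open graph admitting a focused gFlow and let u and v be adjacent vertices with u,v ∉ S ∪ T. Then the open graph ((G∧uv) − {u,v}, S, T), obtained by pivoting G along the edge uv and then deleting both u and v, admits a focused gFlow. -/

import Mathlib

/-- The odd neighbourhood of a set `A`: vertices having an odd number of neighbours in `A`. -/
def oddNbhd {V : Type*} (G : SimpleGraph V) (A : Set V) : Set V :=
  {v | Odd ((G.neighborSet v) ∩ A).ncard}

/-- A focused gFlow on the open graph `(G, S, T)`. -/
def HasFocusedGFlow {V : Type*} (G : SimpleGraph V) (S T : Set V) : Prop :=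
  ∃ (g : V → Set V) (r : V → V → Prop),
    IsStrictOrder V r ∧
    ∀ u, u ∉ T →
      g u ⊆ Sᶜ ∧ oddNbhd G (g u) ∩ Tᶜ = {u} ∧ ∀ v ∈ g u, r u v

/-- Local complementation of `G` at `u`: adjacency between distinct neighbours of `u`
is toggled, all other adjacencies are unchanged. -/
def localComp {V : Type*} (G : SimpleGraph V) (u : V) : SimpleGraph V :=
  SimpleGraph.fromRel (fun x y =>
    (G.Adj u x ∧ G.Adj u y ∧ ¬ G.Adj x y) ∨ (¬(G.Adj u x ∧ G.Adj u y) ∧ G.Adj x y))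

/-- The pivot of `G` along the edge `uv`: `G ∧ uv = ((G ⋆ u) ⋆ v) ⋆ u`. -/
def pivot {V : Type*} (G : SimpleGraph V) (u v : V) : SimpleGraph V :=
  localComp (localComp (localComp G u) v) u

open Classical in
/-- The adjacency indicator of a graph with values in `ZMod 2`. -/
noncomputable def adjBit {V : Type*} (G : SimpleGraph V) (x y : V) : ZMod 2 :=
  if G.Adj x y then 1 else 0

open Classical in
/-- The membership indicator of a set with values in `ZMod 2`. -/
noncomputable def memBit {V : Type*} (A : Set V) (y : V) : ZMod 2 :=
  if y ∈ A then 1 else 0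

theorem mem_oddNbhd_iff_sum {V : Type*} [Fintype V] (G : SimpleGraph V) (A : Set V) (x : V) :
    x ∈ oddNbhd G A ↔ ∑ y, adjBit G x y * memBit A y = 1 := by
  classical
  have hsum : ∑ y, adjBit G x y * memBit A y = ((G.neighborSet x ∩ A).ncard : ZMod 2) := by
    simp only [adjBit, memBit, ← ite_and, mul_ite, mul_one, mul_zero, Finset.sum_boole]
    rw [Set.ncard_eq_toFinset_card']
    congr 2
    ext y
    simp [and_comm]
  rw [hsum, ZMod.natCast_eq_one_iff_odd]
  rfl

theorem localComp_adj {V : Type*} (G : SimpleGraph V) (u x y : V) :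
    (localComp G u).Adj x y ↔
      x ≠ y ∧ ((G.Adj u x ∧ G.Adj u y ∧ ¬ G.Adj x y) ∨
        (¬(G.Adj u x ∧ G.Adj u y) ∧ G.Adj x y)) := by
  have := G.adj_comm x y
  simp only [localComp, SimpleGraph.fromRel_adj]
  tauto

theorem adjBit_pivot {V : Type*} (G : SimpleGraph V) {u v x y : V} (huv : G.Adj u v)
    (hxu : x ≠ u) (hxv : x ≠ v) (hyu : y ≠ u) (hyv : y ≠ v) :
    adjBit (pivot G u v) x y =
      adjBit G x y + adjBit G x u * adjBit G v y + adjBit G x v * adjBit G u y := by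
  have hne := huv.ne
  have h2 : (1 + 1 : ZMod 2) = 0 := by decide
  have hvu := huv.symm
  by_cases hxy : x = y
  · subst hxy
    by_cases h3 : G.Adj u x <;> by_cases h4 : G.Adj v x <;>
      simp [adjBit, G.adj_comm x, h3, h4, h2]
  · by_cases h3 : G.Adj u x <;> by_cases h4 : G.Adj v x <;> by_cases h5 : G.Adj u y <;>
      by_cases h6 : G.Adj v y <;> by_cases h7 : G.Adj x y <;>
      simp [adjBit, pivot, localComp_adj, G.adj_comm x u, G.adj_comm x v, *, hxu.symm, hxv.symm,
        hyu.symm, hyv.symm, hne.symm]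

theorem sum_subtype_ne_ne {V M : Type*} [Fintype V] [AddCommMonoid M] (f : V → M) {u v : V}
    [Fintype {x : V | x ≠ u ∧ x ≠ v}] (huv : u ≠ v) :
    ∑ y, f y = f u + f v + ∑ y : {x : V | x ≠ u ∧ x ≠ v}, f y := by
  classical
  rw [← Finset.sum_pair huv, ← Finset.sum_add_sum_compl {u, v}]
  congr 1
  refine Finset.sum_subtype _ (fun x => ?_) f
  simp

/-- Deleting `u` and `v` after the pivot along `uv` does not change the odd neighbourhoods of
sets which have neither `u` nor `v` in their odd neighbourhood. -/
theorem mem_oddNbhd_pivot_induce {V : Type*} [Finite V] (G : SimpleGraph V) {u v : V}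
    (huv : G.Adj u v) {A : Set V} (hu : u ∉ oddNbhd G A) (hv : v ∉ oddNbhd G A)
    (x : {x : V | x ≠ u ∧ x ≠ v}) :
    x ∈ oddNbhd ((pivot G u v).induce {x | x ≠ u ∧ x ≠ v}) (Subtype.val ⁻¹' A) ↔
      (x : V) ∈ oddNbhd G A := by
  classical
  have := Fintype.ofFinite V
  have hzero : ∀ a : ZMod 2, a ≠ 1 → a = 0 := by decide
  rw [mem_oddNbhd_iff_sum] at hu hv
  replace hu := hzero _ hu
  replace hv := hzero _ hv
  rw [mem_oddNbhd_iff_sum, mem_oddNbhd_iff_sum]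
  rw [sum_subtype_ne_ne _ huv.ne] at hu hv ⊢
  have hbit : ∀ y : {x : V | x ≠ u ∧ x ≠ v},
      adjBit ((pivot G u v).induce {x | x ≠ u ∧ x ≠ v}) x y * memBit (Subtype.val ⁻¹' A) y =
        adjBit G x y * memBit A y + adjBit G x u * (adjBit G v y * memBit A y) +
          adjBit G x v * (adjBit G u y * memBit A y) := fun y => by
    have h : adjBit ((pivot G u v).induce {x | x ≠ u ∧ x ≠ v}) x y = adjBit (pivot G u v) x y :=
      rfl
    have h' : memBit (Subtype.val ⁻¹' A) y = memBit A (y : V) := rfl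
    rw [h, h', adjBit_pivot G huv x.2.1 x.2.2 y.2.1 y.2.2]
    ring
  have huu : adjBit G u u = 0 := by simp [adjBit]
  have hvv : adjBit G v v = 0 := by simp [adjBit]
  have huv' : adjBit G u v = 1 := by simp [adjBit, huv]
  have hvu' : adjBit G v u = 1 := by simp [adjBit, huv.symm]
  rw [huu, huv'] at hu
  rw [hvv, hvu'] at hv
  have h2 : (2 : ZMod 2) = 0 := by decide
  simp only [hbit, Finset.sum_add_distrib, ← Finset.mul_sum]
  apply Eq.congr_left
  linear_combination adjBit G x u * hv + adjBit G x v * hu -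
    (adjBit G x u * memBit A u + adjBit G x v * memBit A v) * h2

/-- Pivoting along an edge `uv` between internal vertices `u, v ∉ S ∪ T` and then
deleting both `u` and `v` preserves admittance of a focused gFlow. -/
theorem pivot_delete_hasFocusedGFlow {V : Type*} [Finite V]
    (G : SimpleGraph V) (S T : Set V) (u v : V)
    (huv : G.Adj u v) (hu : u ∉ S ∪ T) (hv : v ∉ S ∪ T)
    (h : HasFocusedGFlow G S T) :
    HasFocusedGFlow ((pivot G u v).induce {x | x ≠ u ∧ x ≠ v})
      (Subtype.val ⁻¹' S) (Subtype.val ⁻¹' T) := by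
  obtain ⟨g, r, hr, hg⟩ := h
  have hu' : u ∉ T := fun h => hu (Or.inr h)
  have hv' : v ∉ T := fun h => hv (Or.inr h)
  refine ⟨fun w => Subtype.val ⁻¹' g w, fun a b => r a b,
    { irrefl := fun a => hr.irrefl a, trans := fun a b c => hr.trans a b c },
    fun w hw => ?_⟩
  obtain ⟨hS, hodd, hlt⟩ := hg w hw
  have hmem (x : V) (hx : x ∉ T) : x ∈ oddNbhd G (g w) ↔ x = w := by
    have := Set.ext_iff.mp hodd x
    simpa [hx] using this
  refine ⟨fun x hx => hS hx, ?_, fun x hx => hlt x hx⟩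
  ext x
  have hx := mem_oddNbhd_pivot_induce G huv (A := g w)
    (fun h => w.2.1 ((hmem u hu').1 h).symm) (fun h => w.2.2 ((hmem v hv').1 h).symm) x
  rw [Set.mem_inter_iff, hx, Set.mem_singleton_iff, Subtype.ext_iff]
  constructor
  · rintro ⟨h, hxT⟩
    exact (hmem x hxT).1 h
  · intro h
    have hxT : (x : V) ∉ T := h ▸ hw
    exact ⟨(hmem x hxT).2 h, hxT⟩
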